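/- arXiv:1604.06507 — 5 statements merged into one kernel-verified Lean document; each statement's English description precedes it below -/
import Mathlib

section
/- Let ε : P → M be a surjective morphism of left A-modules with P projective, and let f : M → M be a δ-operator on M. Then there exists a δ-operator f̃ : P → P such that ε ∘ f̃ = f ∘ ε; moreover f̃(ker ε) ⊆ ker ε, and the restriction of f̃ to ker ε is a δ-operator on the A-module ker ε. -/
/-- `f` is a `δ`-operator on the left `A`-module `M`: a `k`-linear map with
`f (a • m) = δ a • m + a • f m`. -/
def IsDeltaOperator {k A M : Type*} [CommRing k] [Ring A] [Algebra k A]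
    [AddCommGroup M] [Module k M] [Module A M] [IsScalarTower k A M]
    (δ : A →ₗ[k] A) (f : M →ₗ[k] M) : Prop :=
  ∀ (a : A) (m : M), f (a • m) = δ a • m + a • f m

/-- Every projective `A`-module carries a `δ`-operator, obtained by applying `δ` to the
coordinates with respect to a splitting of the canonical free cover. -/
theorem exists_isDeltaOperator_of_projective
    {k A : Type*} [CommRing k] [Ring A] [Algebra k A]
    (δ : A →ₗ[k] A) (hδ : ∀ a b : A, δ (a * b) = δ a * b + a * δ b)
    (P : Type*) [AddCommGroup P] [Module k P] [Module A P] [IsScalarTower k A P]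
    [Module.Projective A P] :
    ∃ g : P →ₗ[k] P, IsDeltaOperator δ g := by
  obtain ⟨s, hs⟩ := Module.projective_def'.mp ‹Module.Projective A P›
  refine ⟨(Finsupp.linearCombination A (id : P → P)).restrictScalars k ∘ₗ
    Finsupp.mapRange.linearMap δ ∘ₗ s.restrictScalars k, fun a p => ?_⟩
  have hcoord (c : P →₀ A) : Finsupp.mapRange.linearMap δ (a • c) =
      δ a • c + a • Finsupp.mapRange.linearMap δ c := by
    ext q
    simp [hδ]
  have hp : Finsupp.linearCombination A id (s p) = p := LinearMap.congr_fun hs p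
  simp only [LinearMap.comp_apply, LinearMap.restrictScalars_apply, map_smul s, hcoord,
    map_add, map_smul (Finsupp.linearCombination A (id : P → P)), hp]

/-- If `ε : P → M` is a surjective morphism of left `A`-modules with `P` projective and
`f : M → M` is a `δ`-operator, then there is a `δ`-operator `f̃ : P → P` with
`ε ∘ f̃ = f ∘ ε`, `f̃ (ker ε) ⊆ ker ε`, and the restriction of `f̃` to `ker ε` is a
`δ`-operator on `ker ε`. -/
theorem delta_operator_lifts_along_projective_surjection
    {k A M : Type*} [CommRing k] [Ring A] [Algebra k A]
    [AddCommGroup M] [Module k M] [Module A M] [IsScalarTower k A M]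
    (δ : A →ₗ[k] A) (hδ : ∀ a b : A, δ (a * b) = δ a * b + a * δ b)
    (P : Type*) [AddCommGroup P] [Module k P] [Module A P] [IsScalarTower k A P]
    [Module.Projective A P]
    (ε : P →ₗ[A] M) (hε : Function.Surjective ε)
    (f : M →ₗ[k] M) (hf : IsDeltaOperator δ f) :
    ∃ ft : P →ₗ[k] P,
      IsDeltaOperator δ ft ∧
      (∀ p : P, ε (ft p) = f (ε p)) ∧
      (∀ p : P, p ∈ LinearMap.ker ε → ft p ∈ LinearMap.ker ε) ∧
      (∃ ftres : ↥(LinearMap.ker ε) →ₗ[k] ↥(LinearMap.ker ε),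
        (∀ x : ↥(LinearMap.ker ε), (ftres x : P) = ft (x : P)) ∧
        IsDeltaOperator δ ftres) := by
  obtain ⟨g, hg⟩ := exists_isDeltaOperator_of_projective δ hδ P
  let d : P →ₗ[A] M :=
    { toFun := fun p => f (ε p) - ε (g p)
      map_add' := fun p q => by
        simp only [map_add]
        abel
      map_smul' := fun a p => by
        simp only [map_smul ε, hf a, hg a, map_add, RingHom.id_apply, smul_sub]
        abel }
  obtain ⟨h, hh⟩ := Module.projective_lifting_property ε d hε
  have hft : IsDeltaOperator δ (g + h.restrictScalars k) := fun a p => by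
    simp only [LinearMap.add_apply, LinearMap.restrictScalars_apply, hg a, map_smul h, smul_add]
    abel
  have hcomm (p : P) : ε ((g + h.restrictScalars k) p) = f (ε p) := by
    have hp : ε (h p) = f (ε p) - ε (g p) := LinearMap.congr_fun hh p
    simp [hp]
  have hker (p : P) (hp : p ∈ LinearMap.ker ε) :
      (g + h.restrictScalars k) p ∈ LinearMap.ker ε := by
    rw [LinearMap.mem_ker] at hp ⊢
    rw [hcomm, hp, map_zero]
  exact ⟨_, hft, hcomm, hker,
    { toFun := fun x => ⟨_, hker x x.2⟩
      map_add' := fun x y => Subtype.ext (map_add (g + h.restrictScalars k) (x : P) y)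
      map_smul' := fun c x => Subtype.ext (map_smul (g + h.restrictScalars k) c (x : P)) },
    fun _ => rfl, fun a x => Subtype.ext (hft a x)⟩
end

section
/- Let M be a left A-module, f : M → M a δ-operator, let ε : P_• → M and ε' : P'_• → M be projective resolutions of M by left A-modules, let f_• and f'_• be δ-liftings of f to P_• and to P'_• respectively, and let α_• : P'_• → P_• be a chain map of complexes of A-modules lifting the identity of M (i.e. ε ∘ α_0 = ε'). Then every component of the chain map h_• = α_• ∘ f'_• − f_• ∘ α_• : P'_• → P_• is A-linear, and h_• is a chain map over the zero map M → M (that is, ε ∘ h_0 = 0); consequently h_• is A-linearly chain homotopic to zero. -/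
theorem IsDeltaOperator.exists_linearMap_comp_sub_comp {k A M N : Type*} [CommRing k] [Ring A]
    [Algebra k A] [AddCommGroup M] [Module k M] [Module A M] [IsScalarTower k A M]
    [AddCommGroup N] [Module k N] [Module A N] [IsScalarTower k A N]
    {δ : A →ₗ[k] A} {f : M →ₗ[k] M} {g : N →ₗ[k] N}
    (hf : IsDeltaOperator δ f) (hg : IsDeltaOperator δ g) (φ : M →ₗ[A] N) :
    ∃ h : M →ₗ[A] N, ∀ m, h m = φ (f m) - g (φ m) := by
  refine ⟨{ toFun := fun m => φ (f m) - g (φ m), map_add' := ?_, map_smul' := ?_ }, fun _ => rfl⟩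
  · intro x y
    simp only [map_add]
    abel
  · intro a m
    simp only [hf a m, hg a (φ m), map_add, map_smul, RingHom.id_apply, smul_sub]
    abel

theorem LinearMap.exists_comp_eq_of_range_le {A P X Y : Type*} [Ring A]
    [AddCommGroup P] [Module A P] [Module.Projective A P] [AddCommGroup X] [Module A X]
    [AddCommGroup Y] [Module A Y] (d : X →ₗ[A] Y) (g : P →ₗ[A] Y)
    (hg : ∀ p, g p ∈ LinearMap.range d) :
    ∃ s : P →ₗ[A] X, ∀ p, d (s p) = g p := by
  obtain ⟨s, hs⟩ := Module.projective_lifting_property d.rangeRestrict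
    (g.codRestrict (LinearMap.range d) hg) d.surjective_rangeRestrict
  exact ⟨s, fun p => congrArg Subtype.val (LinearMap.congr_fun hs p)⟩

/-- A chain map from a complex of projectives to an exact complex that vanishes on the
augmentation is null-homotopic. -/
theorem exists_homotopy_zero_of_augmentation_comp_eq_zero {A M : Type*} [Ring A]
    [AddCommGroup M] [Module A M]
    {P : ℕ → Type*} [∀ i, AddCommGroup (P i)] [∀ i, Module A (P i)]
    (d : ∀ i, P (i + 1) →ₗ[A] P i) (ε : P 0 →ₗ[A] M)
    (hexact0 : LinearMap.ker ε = LinearMap.range (d 0))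
    (hexact : ∀ i, LinearMap.ker (d i) = LinearMap.range (d (i + 1)))
    {P' : ℕ → Type*} [∀ i, AddCommGroup (P' i)] [∀ i, Module A (P' i)]
    [∀ i, Module.Projective A (P' i)]
    (d' : ∀ i, P' (i + 1) →ₗ[A] P' i) (hd' : ∀ i p, d' i (d' (i + 1) p) = 0)
    (h : ∀ i, P' i →ₗ[A] P i) (hε : ∀ p, ε (h 0 p) = 0)
    (hd : ∀ i p, d i (h (i + 1) p) = h i (d' i p)) :
    ∃ s : ∀ i, P' i →ₗ[A] P (i + 1),
      (∀ p, h 0 p = d 0 (s 0 p)) ∧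
      ∀ i p, h (i + 1) p = d (i + 1) (s (i + 1) p) + s i (d' i p) := by
  obtain ⟨s₀, hs₀⟩ := (d 0).exists_comp_eq_of_range_le (h 0) fun p =>
    hexact0 ▸ LinearMap.mem_ker.2 (hε p)
  have step : ∀ i (s : {s : P' i →ₗ[A] P (i + 1) //
        ∀ p, d i (s (d' i p)) = d i (h (i + 1) p)}),
      ∃ t : {t : P' (i + 1) →ₗ[A] P (i + 2) //
        ∀ p, d (i + 1) (t (d' (i + 1) p)) = d (i + 1) (h (i + 2) p)},
      ∀ p, d (i + 1) (t.1 p) = h (i + 1) p - s.1 (d' i p) := by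
    rintro i ⟨s, hs⟩
    obtain ⟨t, ht⟩ := (d (i + 1)).exists_comp_eq_of_range_le (h (i + 1) - s ∘ₗ d' i) fun p => by
      rw [← hexact i, LinearMap.mem_ker]
      simp [hs]
    refine ⟨⟨t, fun p => ?_⟩, fun p => by simpa using ht p⟩
    rw [ht, hd]
    simp [hd']
  choose next hnext using step
  let s : ∀ i, {s : P' i →ₗ[A] P (i + 1) // ∀ p, d i (s (d' i p)) = d i (h (i + 1) p)} :=
    fun i => Nat.rec ⟨s₀, fun p => by rw [hs₀, hd]⟩ next i
  refine ⟨fun i => (s i).1, fun p => (hs₀ p).symm, fun i p => ?_⟩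
  exact eq_add_of_sub_eq (hnext i (s i) p).symm

/-- Given `δ`-liftings `F`, `F'` of a `δ`-operator `f` to projective resolutions `P_•`,
`P'_•` of `M`, and a chain map `α : P'_• → P_•` of complexes of `A`-modules lifting
`id_M`, each component of `h = α ∘ F' − F ∘ α` is `A`-linear, `h` lifts the zero map
(`ε ∘ h 0 = 0`), and `h` is `A`-linearly chain homotopic to zero. -/
theorem comparison_commutes_up_to_homotopy
    {k A M : Type*} [CommRing k] [Ring A] [Algebra k A]
    [AddCommGroup M] [Module k M] [Module A M] [IsScalarTower k A M]
    (δ : A →ₗ[k] A) (hδ : ∀ a b : A, δ (a * b) = δ a * b + a * δ b)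
    (P : ℕ → Type*) [∀ i, AddCommGroup (P i)] [∀ i, Module k (P i)]
    [∀ i, Module A (P i)] [∀ i, IsScalarTower k A (P i)]
    [∀ i, Module.Projective A (P i)]
    (d : ∀ i, P (i + 1) →ₗ[A] P i) (ε : P 0 →ₗ[A] M)
    (hsurj : Function.Surjective ε)
    (hexact0 : LinearMap.ker ε = LinearMap.range (d 0))
    (hexact : ∀ i, LinearMap.ker (d i) = LinearMap.range (d (i + 1)))
    (P' : ℕ → Type*) [∀ i, AddCommGroup (P' i)] [∀ i, Module k (P' i)]
    [∀ i, Module A (P' i)] [∀ i, IsScalarTower k A (P' i)]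
    [∀ i, Module.Projective A (P' i)]
    (d' : ∀ i, P' (i + 1) →ₗ[A] P' i) (ε' : P' 0 →ₗ[A] M)
    (hsurj' : Function.Surjective ε')
    (hexact0' : LinearMap.ker ε' = LinearMap.range (d' 0))
    (hexact' : ∀ i, LinearMap.ker (d' i) = LinearMap.range (d' (i + 1)))
    (f : M →ₗ[k] M) (hf : IsDeltaOperator δ f)
    (F : ∀ i, P i →ₗ[k] P i)
    (hF0 : ∀ i, IsDeltaOperator δ (F i))
    (hFε : ∀ p : P 0, ε (F 0 p) = f (ε p))
    (hFd : ∀ i (p : P (i + 1)), d i (F (i + 1) p) = F i (d i p))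
    (F' : ∀ i, P' i →ₗ[k] P' i)
    (hF'0 : ∀ i, IsDeltaOperator δ (F' i))
    (hF'ε : ∀ p : P' 0, ε' (F' 0 p) = f (ε' p))
    (hF'd : ∀ i (p : P' (i + 1)), d' i (F' (i + 1) p) = F' i (d' i p))
    (α : ∀ i, P' i →ₗ[A] P i)
    (hα0 : ∀ p : P' 0, ε (α 0 p) = ε' p)
    (hαd : ∀ i (p : P' (i + 1)), d i (α (i + 1) p) = α i (d' i p)) :
    (∀ i, ∃ h : P' i →ₗ[A] P i, ∀ p : P' i, h p = α i (F' i p) - F i (α i p)) ∧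
    (∀ p : P' 0, ε (α 0 (F' 0 p) - F 0 (α 0 p)) = 0) ∧
    (∃ s : ∀ i, P' i →ₗ[A] P (i + 1),
      (∀ p : P' 0, α 0 (F' 0 p) - F 0 (α 0 p) = d 0 (s 0 p)) ∧
      (∀ i (p : P' (i + 1)),
        α (i + 1) (F' (i + 1) p) - F (i + 1) (α (i + 1) p)
          = d (i + 1) (s (i + 1) p) + s i (d' i p))) := by
  choose h hh using fun i => (hF'0 i).exists_linearMap_comp_sub_comp (hF0 i) (α i)
  have hε : ∀ p : P' 0, ε (α 0 (F' 0 p) - F 0 (α 0 p)) = 0 := fun p => by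
    rw [map_sub, hα0, hF'ε, hFε, hα0, sub_self]
  refine ⟨fun i => ⟨h i, hh i⟩, hε, ?_⟩
  have hd' : ∀ i p, d' i (d' (i + 1) p) = 0 := fun i p =>
    LinearMap.mem_ker.1 (hexact' i ▸ LinearMap.mem_range_self (d' (i + 1)) p)
  obtain ⟨s, hs₀, hs⟩ := exists_homotopy_zero_of_augmentation_comp_eq_zero d ε hexact0 hexact
    d' hd' h (fun p => by rw [hh, hε]) fun i p => by
      rw [hh, hh, map_sub, hαd, hF'd, hFd, hαd]
  exact ⟨s, fun p => by rw [← hh, hs₀], fun i p => by rw [← hh, hs]⟩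
end

section
/- Let M be a left A-module, f : M → M a δ-operator, ε : P_• → M a projective resolution of M by left A-modules, and let f_• and f'_• be two δ-liftings of f to P_•. Then the morphisms of cochain complexes f_•^♯ and f'_•^♯ on Hom_A(P_•, M), given by f_i^♯(φ) = f ∘ φ − φ ∘ f_i and f'_i^♯(φ) = f ∘ φ − φ ∘ f'_i, induce the same map on cohomology in every degree. -/
/-- The difference of two `δ`-operators, as an `A`-linear map. -/
def IsDeltaOperator.subLinear {k A M : Type*} [CommRing k] [Ring A] [Algebra k A]
    [AddCommGroup M] [Module k M] [Module A M] [IsScalarTower k A M]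
    {δ : A →ₗ[k] A} {f g : M →ₗ[k] M}
    (hf : IsDeltaOperator δ f) (hg : IsDeltaOperator δ g) : M →ₗ[A] M where
  toFun m := f m - g m
  map_add' x y := by simp only [map_add]; abel
  map_smul' a m := by
    rw [hf, hg, RingHom.id_apply, smul_sub]
    abel

/-- A linear map from a projective module lifts along any linear map whose range contains its
values. -/
theorem Module.Projective.exists_lift_of_mem_range {A Q N N' : Type*} [Ring A]
    [AddCommGroup Q] [Module A Q] [Module.Projective A Q]
    [AddCommGroup N] [Module A N] [AddCommGroup N'] [Module A N']
    (h : Q →ₗ[A] N) (d : N' →ₗ[A] N) (hr : ∀ q, h q ∈ LinearMap.range d) :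
    ∃ s : Q →ₗ[A] N', ∀ q, d (s q) = h q := by
  obtain ⟨s, hs⟩ := Module.projective_lifting_property d.rangeRestrict
    (h.codRestrict (LinearMap.range d) hr) d.surjective_rangeRestrict
  exact ⟨s, fun q => congrArg Subtype.val (LinearMap.congr_fun hs q)⟩

/-- A chain endomorphism `g` of a projective resolution that lifts zero is null-homotopic: in each
degree there is `s` such that `g - s ∘ d` takes values in cycles. -/
theorem exists_homotopy_of_lift_zero {A M : Type*} [Ring A] [AddCommGroup M] [Module A M]
    (P : ℕ → Type*) [∀ i, AddCommGroup (P i)] [∀ i, Module A (P i)]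
    [∀ i, Module.Projective A (P i)]
    (d : ∀ i, P (i + 1) →ₗ[A] P i) (ε : P 0 →ₗ[A] M)
    (hexact0 : LinearMap.ker ε = LinearMap.range (d 0))
    (hexact : ∀ i, LinearMap.ker (d i) = LinearMap.range (d (i + 1)))
    (g : ∀ i, P i →ₗ[A] P i) (hgε : ∀ p, ε (g 0 p) = 0)
    (hgd : ∀ i (p : P (i + 1)), d i (g (i + 1) p) = g i (d i p)) (i : ℕ) :
    ∃ s : P i →ₗ[A] P (i + 1), ∀ p : P (i + 1), d i (g (i + 1) p - s (d i p)) = 0 := by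
  induction i with
  | zero =>
    obtain ⟨s, hs⟩ := Module.Projective.exists_lift_of_mem_range (g 0) (d 0)
      fun q => hexact0 ▸ LinearMap.mem_ker.2 (hgε q)
    exact ⟨s, fun p => by rw [map_sub, hs, hgd, sub_self]⟩
  | succ i ih =>
    obtain ⟨s, hs⟩ := ih
    obtain ⟨s', hs'⟩ := Module.Projective.exists_lift_of_mem_range
      (g (i + 1) - s ∘ₗ d i) (d (i + 1)) fun q => hexact i ▸ LinearMap.mem_ker.2 (hs q)
    refine ⟨s', fun p => ?_⟩
    have hdd : d i (d (i + 1) p) = 0 :=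
      LinearMap.mem_ker.1 (hexact i ▸ LinearMap.mem_range_self (d (i + 1)) p)
    rw [map_sub, hs', hgd, LinearMap.sub_apply, LinearMap.comp_apply, hdd, map_zero, sub_zero,
      sub_self]

/-- Two `δ`-liftings `F`, `F'` of a `δ`-operator `f` to a projective resolution `P_•` of
`M` induce the same map on the cohomology of `Hom_A(P_•, M)` in every degree: on every
cocycle `φ` the values of `F♯` and `F'♯` differ by a coboundary (and agree in degree
`0`, where there are no coboundaries). -/
theorem sharp_maps_agree_on_cohomology
    {k A M : Type*} [CommRing k] [Ring A] [Algebra k A]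
    [AddCommGroup M] [Module k M] [Module A M] [IsScalarTower k A M]
    (δ : A →ₗ[k] A) (hδ : ∀ a b : A, δ (a * b) = δ a * b + a * δ b)
    (P : ℕ → Type*) [∀ i, AddCommGroup (P i)] [∀ i, Module k (P i)]
    [∀ i, Module A (P i)] [∀ i, IsScalarTower k A (P i)]
    [∀ i, Module.Projective A (P i)]
    (d : ∀ i, P (i + 1) →ₗ[A] P i) (ε : P 0 →ₗ[A] M)
    (hsurj : Function.Surjective ε)
    (hexact0 : LinearMap.ker ε = LinearMap.range (d 0))
    (hexact : ∀ i, LinearMap.ker (d i) = LinearMap.range (d (i + 1)))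
    (f : M →ₗ[k] M) (hf : IsDeltaOperator δ f)
    (F F' : ∀ i, P i →ₗ[k] P i)
    (hF0 : ∀ i, IsDeltaOperator δ (F i)) (hF'0 : ∀ i, IsDeltaOperator δ (F' i))
    (hFε : ∀ p : P 0, ε (F 0 p) = f (ε p)) (hF'ε : ∀ p : P 0, ε (F' 0 p) = f (ε p))
    (hFd : ∀ i (p : P (i + 1)), d i (F (i + 1) p) = F i (d i p))
    (hF'd : ∀ i (p : P (i + 1)), d i (F' (i + 1) p) = F' i (d i p)) :
    (∀ φ : P 0 →ₗ[A] M, (∀ p : P 1, φ (d 0 p) = 0) →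
      ∀ p : P 0, f (φ p) - φ (F 0 p) = f (φ p) - φ (F' 0 p)) ∧
    (∀ i (φ : P (i + 1) →ₗ[A] M), (∀ p : P (i + 2), φ (d (i + 1) p) = 0) →
      ∃ ψ : P i →ₗ[A] M,
        ∀ p : P (i + 1),
          (f (φ p) - φ (F (i + 1) p)) - (f (φ p) - φ (F' (i + 1) p)) = ψ (d i p)) := by
  let g : ∀ i, P i →ₗ[A] P i := fun i => (hF0 i).subLinear (hF'0 i)
  have hg : ∀ i p, g i p = F i p - F' i p := fun _ _ => rfl
  have hgε : ∀ p, ε (g 0 p) = 0 := fun p => by rw [hg, map_sub, hFε, hF'ε, sub_self]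
  have hgd : ∀ i (p : P (i + 1)), d i (g (i + 1) p) = g i (d i p) := fun i p => by
    rw [hg, hg, map_sub, hFd, hF'd]
  refine ⟨fun φ hφ p => ?_, fun i φ hφ => ?_⟩
  · obtain ⟨q, hq⟩ : g 0 p ∈ LinearMap.range (d 0) := hexact0 ▸ LinearMap.mem_ker.2 (hgε p)
    have h := hφ q
    rw [hq, hg, map_sub, sub_eq_zero] at h
    rw [h]
  · obtain ⟨s, hs⟩ := exists_homotopy_of_lift_zero P d ε hexact0 hexact g hgε hgd i
    refine ⟨-(φ ∘ₗ s), fun p => ?_⟩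
    obtain ⟨q, hq⟩ : g (i + 1) p - s (d i p) ∈ LinearMap.range (d (i + 1)) :=
      hexact i ▸ LinearMap.mem_ker.2 (hs p)
    have h := hφ q
    rw [hq, map_sub, hg, map_sub, sub_eq_zero] at h
    rw [LinearMap.neg_apply, LinearMap.comp_apply, ← h]
    abel
end

section
/- Let M be a left A-module and f : M → M a δ-operator on M. Then for each n ≥ 0 there exists a k-linear map ∇_f^n : Ext_A^n(M, M) → Ext_A^n(M, M) such that for every projective resolution ε : P_• → M by left A-modules and every δ-lifting f_• of f to P_•, the map induced on the n-th cohomology of the complex Hom_A(P_•, M) by the chain map f_•^♯ (where f_i^♯(φ) = f ∘ φ − φ ∘ f_i) corresponds to ∇_f^n under the canonical isomorphism between Ext_A^n(M, M) and the n-th cohomology of Hom_A(P_•, M). -/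
universe u v

/-- A projective resolution `⋯ → P 1 → P 0 → M → 0` of a left `A`-module `M`. -/
structure ProjResolution (k A : Type u) (M : Type v) [CommRing k] [Ring A] [Algebra k A]
    [AddCommGroup M] [Module k M] [Module A M] [IsScalarTower k A M] where
  P : ℕ → Type v
  [acg : ∀ n, AddCommGroup (P n)]
  [modk : ∀ n, Module k (P n)]
  [modA : ∀ n, Module A (P n)]
  [tower : ∀ n, IsScalarTower k A (P n)]
  [proj : ∀ n, Module.Projective A (P n)]
  d : ∀ n, P (n + 1) →ₗ[A] P n
  aug : P 0 →ₗ[A] M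
  surj : Function.Surjective aug
  exact0 : LinearMap.ker aug = LinearMap.range (d 0)
  exact : ∀ n, LinearMap.ker (d n) = LinearMap.range (d (n + 1))

attribute [instance] ProjResolution.acg ProjResolution.modk ProjResolution.modA
  ProjResolution.tower ProjResolution.proj

variable {k A : Type u} {M : Type v} [CommRing k] [Ring A] [Algebra k A]
  [AddCommGroup M] [Module k M] [Module A M] [IsScalarTower k A M]

/-- The differential of the cochain complex `Hom_A(P_•, M)`: precomposition with `d n`. -/
def homD (R : ProjResolution k A M) (n : ℕ) :
    (R.P n →ₗ[A] M) →ₗ[k] (R.P (n + 1) →ₗ[A] M) where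
  toFun φ := φ ∘ₗ R.d n
  map_add' φ ψ := LinearMap.add_comp _ _ _
  map_smul' c φ := LinearMap.smul_comp _ _ _

/-- The `k`-submodule of `n`-cocycles of the complex `Hom_A(P_•, M)`. -/
def homCocycles (R : ProjResolution k A M) (n : ℕ) : Submodule k (R.P n →ₗ[A] M) :=
  LinearMap.ker (homD R n)

/-- The `k`-submodule of `n`-coboundaries of the complex `Hom_A(P_•, M)`. -/
def homCoboundaries (R : ProjResolution k A M) : ∀ n, Submodule k (R.P n →ₗ[A] M)
  | 0 => ⊥
  | (n + 1) => LinearMap.range (homD R n)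

/-- The coboundaries, seen inside the module of cocycles. -/
def homCoboundariesIn (R : ProjResolution k A M) (n : ℕ) :
    Submodule k (homCocycles R n) :=
  (homCoboundaries R n).comap (homCocycles R n).subtype

/-- The `n`-th cohomology of the complex `Hom_A(P_•, M)`, which computes
`Ext_A^n(M, M)` when `M` is the second argument as well. -/
abbrev homCohomology (R : ProjResolution k A M) (n : ℕ) :=
  homCocycles R n ⧸ homCoboundariesIn R n

section DeltaOperators

variable {δ : A →ₗ[k] A} {P Q N : Type*}
  [AddCommGroup P] [Module k P] [Module A P] [IsScalarTower k A P]
  [AddCommGroup Q] [Module k Q] [Module A Q] [IsScalarTower k A Q]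
  [AddCommGroup N] [Module A N]

/-- The commutator `u ↦ G ∘ u - u ∘ F` with two `δ`-operators preserves `A`-linearity. -/
def deltaCommutator {F : P →ₗ[k] P} {G : Q →ₗ[k] Q}
    (hF : IsDeltaOperator δ F) (hG : IsDeltaOperator δ G) :
    (P →ₗ[A] Q) →ₗ[k] (P →ₗ[A] Q) where
  toFun u :=
    { toFun := fun p => G (u p) - u (F p)
      map_add' := fun p q => by simp only [map_add]; abel
      map_smul' := fun a p => by
        simp only [map_smul, hF a p, hG a (u p), map_add, RingHom.id_apply, smul_sub]
        abel }
  map_add' u v := by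
    ext p
    simp only [LinearMap.coe_mk, AddHom.coe_mk, LinearMap.add_apply, map_add]
    abel
  map_smul' c u := by
    ext p
    simp [smul_sub]

@[simp]
theorem deltaCommutator_apply {F : P →ₗ[k] P} {G : Q →ₗ[k] Q}
    (hF : IsDeltaOperator δ F) (hG : IsDeltaOperator δ G) (u : P →ₗ[A] Q) (p : P) :
    deltaCommutator hF hG u p = G (u p) - u (F p) := rfl

/-- The lifting property of a projective module against a map whose range contains the image. -/
theorem exists_lift_of_range_le [Module.Projective A P] {L : Type*} [AddCommGroup L] [Module A L]
    (d : L →ₗ[A] N) (g : P →ₗ[A] N) (h : ∀ p, g p ∈ LinearMap.range d) :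
    ∃ l : P →ₗ[A] L, ∀ p, d (l p) = g p := by
  obtain ⟨l, hl⟩ := Module.projective_lifting_property d.rangeRestrict
    (g.codRestrict (LinearMap.range d) h) d.surjective_rangeRestrict
  exact ⟨l, fun p => congrArg Subtype.val (LinearMap.congr_fun hl p)⟩

theorem IsDeltaOperator.add_linear {F : P →ₗ[k] P} (hF : IsDeltaOperator δ F) (h : P →ₗ[A] P) :
    IsDeltaOperator δ (F + h.restrictScalars k) := by
  intro a p
  simp only [LinearMap.add_apply, LinearMap.restrictScalars_apply, hF a p, map_smul, smul_add]
  abel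

/-- Every projective module carries a `δ`-operator. -/
theorem exists_isDeltaOperator (hδ : ∀ a b : A, δ (a * b) = δ a * b + a * δ b)
    (P : Type*) [AddCommGroup P] [Module k P] [Module A P] [IsScalarTower k A P]
    [Module.Projective A P] :
    ∃ D : P →ₗ[k] P, IsDeltaOperator δ D := by
  obtain ⟨s, hs⟩ := Module.projective_def'.mp (inferInstance : Module.Projective A P)
  let π : (P →₀ A) →ₗ[A] P := Finsupp.linearCombination A id
  have hπ (p : P) : π (s p) = p := LinearMap.congr_fun hs p
  let E : (P →₀ A) →ₗ[k] (P →₀ A) := Finsupp.mapRange.linearMap δ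
  have hE : IsDeltaOperator δ E := by
    intro a x
    ext p
    simp [E, hδ]
  refine ⟨π.restrictScalars k ∘ₗ E ∘ₗ s.restrictScalars k, fun a p => ?_⟩
  simp only [LinearMap.comp_apply, LinearMap.restrictScalars_apply, map_smul, hE a (s p), map_add,
    hπ]

/-- A `δ`-operator preserving the range of `d` lifts along `d` to a projective source. -/
theorem exists_isDeltaOperator_lift (hδ : ∀ a b : A, δ (a * b) = δ a * b + a * δ b)
    [Module.Projective A P] (d : P →ₗ[A] Q) {G : Q →ₗ[k] Q} (hG : IsDeltaOperator δ G)
    (h : ∀ p, G (d p) ∈ LinearMap.range d) :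
    ∃ F : P →ₗ[k] P, IsDeltaOperator δ F ∧ ∀ p, d (F p) = G (d p) := by
  obtain ⟨D, hD⟩ := exists_isDeltaOperator hδ P
  obtain ⟨l, hl⟩ := exists_lift_of_range_le d (deltaCommutator hD hG d)
    fun p => sub_mem (h p) ⟨D p, rfl⟩
  refine ⟨_, hD.add_linear l, fun p => ?_⟩
  simp [hl]

end DeltaOperators

namespace ProjResolution

/-- `F` is a `δ`-lifting of `f` to the resolution `R`. -/
structure IsDeltaLifting (R : ProjResolution k A M) (δ : A →ₗ[k] A) (f : M →ₗ[k] M)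
    (F : ∀ n, R.P n →ₗ[k] R.P n) : Prop where
  isDeltaOperator : ∀ n, IsDeltaOperator δ (F n)
  aug_comm : ∀ p, R.aug (F 0 p) = f (R.aug p)
  d_comm : ∀ n p, R.d n (F (n + 1) p) = F n (R.d n p)

section Complex

variable (R : ProjResolution k A M)

theorem aug_d (p : R.P 1) : R.aug (R.d 0 p) = 0 := by
  have : R.d 0 p ∈ LinearMap.ker R.aug := R.exact0 ▸ ⟨p, rfl⟩
  exact this

theorem d_d (n : ℕ) (p : R.P (n + 2)) : R.d n (R.d (n + 1) p) = 0 := by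
  have : R.d (n + 1) p ∈ LinearMap.ker (R.d n) := R.exact n ▸ ⟨p, rfl⟩
  exact this

theorem mem_range_d_zero {x : R.P 0} (hx : R.aug x = 0) : x ∈ LinearMap.range (R.d 0) :=
  R.exact0 ▸ LinearMap.mem_ker.mpr hx

theorem mem_range_d_succ {n : ℕ} {x : R.P (n + 1)} (hx : R.d n x = 0) :
    x ∈ LinearMap.range (R.d (n + 1)) :=
  R.exact n ▸ LinearMap.mem_ker.mpr hx

end Complex

variable {δ : A →ₗ[k] A} {f : M →ₗ[k] M}

/-- Every `δ`-operator on `M` lifts to every projective resolution of `M`. -/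
theorem exists_isDeltaLifting (R : ProjResolution k A M)
    (hδ : ∀ a b : A, δ (a * b) = δ a * b + a * δ b) (hf : IsDeltaOperator δ f) :
    ∃ F : ∀ n, R.P n →ₗ[k] R.P n, R.IsDeltaLifting δ f F := by
  obtain ⟨F₀, hF₀, haug⟩ := exists_isDeltaOperator_lift hδ R.aug hf
    fun p => R.surj (f (R.aug p))
  have step (n : ℕ) (G : {G : R.P n →ₗ[k] R.P n //
      IsDeltaOperator δ G ∧ ∀ p, G (R.d n p) ∈ LinearMap.range (R.d n)}) :
      ∃ F : {F : R.P (n + 1) →ₗ[k] R.P (n + 1) //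
        IsDeltaOperator δ F ∧ ∀ p, F (R.d (n + 1) p) ∈ LinearMap.range (R.d (n + 1))},
        ∀ p, R.d n (F.1 p) = G.1 (R.d n p) := by
    obtain ⟨F, hF, hd⟩ := exists_isDeltaOperator_lift hδ (R.d n) G.2.1 G.2.2
    refine ⟨⟨F, hF, fun p => R.mem_range_d_succ ?_⟩, hd⟩
    rw [hd, d_d, map_zero]
  choose next hnext using step
  let F (n : ℕ) : {G : R.P n →ₗ[k] R.P n //
      IsDeltaOperator δ G ∧ ∀ p, G (R.d n p) ∈ LinearMap.range (R.d n)} :=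
    Nat.rec ⟨F₀, hF₀, fun p => R.mem_range_d_zero (by rw [haug, aug_d, map_zero])⟩ next n
  exact ⟨fun n => (F n).1, fun n => (F n).2.1, haug, fun n => hnext n (F n)⟩

/-- A chain map lifting zero is null-homotopic; its homotopy is recorded one degree at a time. -/
theorem exists_homotopy {R R' : ProjResolution k A M} (β : ∀ n, R'.P n →ₗ[A] R.P n)
    (h₀ : ∀ p, R.aug (β 0 p) = 0) (hβ : ∀ n p, R.d n (β (n + 1) p) = β n (R'.d n p)) (n : ℕ) :
    ∃ h : R'.P n →ₗ[A] R.P (n + 1), ∀ p, R.d n (h (R'.d n p)) = β n (R'.d n p) := by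
  induction n with
  | zero =>
    obtain ⟨h, hh⟩ := exists_lift_of_range_le (R.d 0) (β 0) fun p => R.mem_range_d_zero (h₀ p)
    exact ⟨h, fun p => hh _⟩
  | succ n ih =>
    obtain ⟨h, hh⟩ := ih
    obtain ⟨h', hh'⟩ := exists_lift_of_range_le (R.d (n + 1)) (β (n + 1) - h ∘ₗ R'.d n)
      fun p => R.mem_range_d_succ (by simp [hβ, hh])
    exact ⟨h', fun p => by simp [hh', d_d]⟩

theorem homCocycles_apply_d {R : ProjResolution k A M} {n : ℕ} {φ : R.P n →ₗ[A] M}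
    (hφ : φ ∈ homCocycles R n) (p : R.P (n + 1)) : φ (R.d n p) = 0 :=
  LinearMap.congr_fun (LinearMap.mem_ker.mp hφ) p

/-- A chain map lifting zero pulls cocycles back to coboundaries. -/
theorem comp_mem_homCoboundaries {R R' : ProjResolution k A M} (β : ∀ n, R'.P n →ₗ[A] R.P n)
    (h₀ : ∀ p, R.aug (β 0 p) = 0) (hβ : ∀ n p, R.d n (β (n + 1) p) = β n (R'.d n p))
    {n : ℕ} {φ : R.P n →ₗ[A] M} (hφ : φ ∈ homCocycles R n) :
    φ ∘ₗ β n ∈ homCoboundaries R' n := by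
  cases n with
  | zero =>
    refine (Submodule.mem_bot k).mpr (LinearMap.ext fun p => ?_)
    obtain ⟨q, hq⟩ := R.mem_range_d_zero (h₀ p)
    simp [← hq, homCocycles_apply_d hφ]
  | succ n =>
    obtain ⟨h, hh⟩ := exists_homotopy β h₀ hβ n
    refine ⟨φ ∘ₗ h, LinearMap.ext fun p => ?_⟩
    obtain ⟨q, hq⟩ : β (n + 1) p - h (R'.d n p) ∈ LinearMap.range (R.d (n + 1)) :=
      R.mem_range_d_succ (by simp [hβ, hh])
    have hφq := homCocycles_apply_d hφ q
    rw [hq, map_sub, sub_eq_zero] at hφq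
    exact hφq.symm

/-- Pulling back along a chain map preserves coboundaries. -/
theorem comp_chainMap_mem_homCoboundaries {R R' : ProjResolution k A M}
    (α : ∀ n, R'.P n →ₗ[A] R.P n) (hα : ∀ n p, R.d n (α (n + 1) p) = α n (R'.d n p))
    {n : ℕ} {φ : R.P n →ₗ[A] M} (hφ : φ ∈ homCoboundaries R n) :
    φ ∘ₗ α n ∈ homCoboundaries R' n := by
  cases n with
  | zero =>
    obtain rfl := (Submodule.mem_bot k).mp hφ
    exact (Submodule.mem_bot k).mpr (LinearMap.zero_comp _)
  | succ n =>
    obtain ⟨ψ, rfl⟩ := hφ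
    exact ⟨ψ ∘ₗ α n, LinearMap.ext fun p => congrArg ψ (hα n p).symm⟩

theorem homCohomology_mk_eq_iff {R : ProjResolution k A M} {n : ℕ} {φ ψ : homCocycles R n} :
    (Submodule.Quotient.mk φ : homCohomology R n) = Submodule.Quotient.mk ψ ↔
      (φ : R.P n →ₗ[A] M) - ψ ∈ homCoboundaries R n :=
  Submodule.Quotient.eq _

namespace IsDeltaLifting

section Nabla

variable {R : ProjResolution k A M} {F : ∀ n, R.P n →ₗ[k] R.P n}

theorem deltaCommutator_mem_homCocycles (hF : R.IsDeltaLifting δ f F) (hf : IsDeltaOperator δ f)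
    {n : ℕ} {φ : R.P n →ₗ[A] M} (hφ : φ ∈ homCocycles R n) :
    deltaCommutator (hF.isDeltaOperator n) hf φ ∈ homCocycles R n := by
  refine LinearMap.mem_ker.mpr (LinearMap.ext fun p => ?_)
  change f (φ (R.d n p)) - φ (F n (R.d n p)) = 0
  rw [← hF.d_comm, homCocycles_apply_d hφ, homCocycles_apply_d hφ, map_zero, sub_zero]

theorem deltaCommutator_mem_homCoboundaries (hF : R.IsDeltaLifting δ f F)
    (hf : IsDeltaOperator δ f) {n : ℕ} {φ : R.P n →ₗ[A] M} (hφ : φ ∈ homCoboundaries R n) :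
    deltaCommutator (hF.isDeltaOperator n) hf φ ∈ homCoboundaries R n := by
  cases n with
  | zero =>
    obtain rfl := (Submodule.mem_bot k).mp hφ
    rw [map_zero]
    exact zero_mem _
  | succ n =>
    obtain ⟨ψ, rfl⟩ := hφ
    refine ⟨deltaCommutator (hF.isDeltaOperator n) hf ψ, LinearMap.ext fun p => ?_⟩
    change f (ψ (R.d n p)) - ψ (F n (R.d n p)) = f (ψ (R.d n p)) - ψ (R.d n (F (n + 1) p))
    rw [hF.d_comm]

/-- The endomorphism of cohomology induced by the chain map `φ ↦ f ∘ φ - φ ∘ F`. -/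
def nabla (hF : R.IsDeltaLifting δ f F) (hf : IsDeltaOperator δ f) (n : ℕ) :
    homCohomology R n →ₗ[k] homCohomology R n :=
  Submodule.mapQ _ _
    ((deltaCommutator (hF.isDeltaOperator n) hf).restrict
      fun _ hφ => hF.deltaCommutator_mem_homCocycles hf hφ)
    fun _ hφ => hF.deltaCommutator_mem_homCoboundaries hf hφ

theorem nabla_mk_eq_iff (hF : R.IsDeltaLifting δ f F) (hf : IsDeltaOperator δ f) {n : ℕ}
    {φ ψ : homCocycles R n} :
    hF.nabla hf n (Submodule.Quotient.mk φ) = Submodule.Quotient.mk ψ ↔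
      deltaCommutator (hF.isDeltaOperator n) hf φ - (ψ : R.P n →ₗ[A] M) ∈ homCoboundaries R n :=
  homCohomology_mk_eq_iff

end Nabla

/-- The commutators with `δ`-liftings on two resolutions agree up to coboundaries. -/
theorem deltaCommutator_comp_sub_mem {R R' : ProjResolution k A M}
    {F : ∀ n, R.P n →ₗ[k] R.P n} {F' : ∀ n, R'.P n →ₗ[k] R'.P n}
    (hF : R.IsDeltaLifting δ f F) (hF' : R'.IsDeltaLifting δ f F') (hf : IsDeltaOperator δ f)
    (α : ∀ n, R'.P n →ₗ[A] R.P n) (haug : ∀ p, R.aug (α 0 p) = R'.aug p)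
    (hα : ∀ n p, R.d n (α (n + 1) p) = α n (R'.d n p))
    {n : ℕ} {φ : R.P n →ₗ[A] M} (hφ : φ ∈ homCocycles R n) :
    deltaCommutator (hF'.isDeltaOperator n) hf (φ ∘ₗ α n) -
      deltaCommutator (hF.isDeltaOperator n) hf φ ∘ₗ α n ∈ homCoboundaries R' n := by
  convert comp_mem_homCoboundaries
    (fun n => deltaCommutator (hF'.isDeltaOperator n) (hF.isDeltaOperator n) (α n))
    (fun p => by simp [hF.aug_comm, haug, hF'.aug_comm])
    (fun n p => by simp [hF.d_comm, hα, hF'.d_comm]) hφ using 1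
  ext p
  simp

end IsDeltaLifting

end ProjResolution

open ProjResolution

/-- **Theorem (∇_f on Ext).** Let `f` be a `δ`-operator on `M`. There is a canonical
family of `k`-linear endomorphisms `∇` of `Ext_A^n(M, M)`, here realized simultaneously
on the cohomology of `Hom_A(P_•, M)` for every projective resolution `P_•` of `M`:
(1) for every resolution `R`, every `δ`-lifting `F` of `f` to `R` and every cocycle `φ`,
`∇` sends the class of `φ` to the class of `f ∘ φ − φ ∘ F n`; (2) `∇` is compatible with
the canonical identifications of the cohomologies of any two resolutions, i.e. with the
maps induced by any chain map `α : P'_• → P_•` lifting `id_M`. -/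
theorem nabla_exists_on_Ext
    (δ : A →ₗ[k] A) (hδ : ∀ a b : A, δ (a * b) = δ a * b + a * δ b)
    (f : M →ₗ[k] M) (hf : IsDeltaOperator δ f) :
    ∃ Nabla : ∀ (R : ProjResolution k A M) (n : ℕ),
        homCohomology R n →ₗ[k] homCohomology R n,
      (∀ (R : ProjResolution k A M) (F : ∀ n, R.P n →ₗ[k] R.P n),
        (∀ n, IsDeltaOperator δ (F n)) →
        (∀ p, R.aug (F 0 p) = f (R.aug p)) →
        (∀ n p, R.d n (F (n + 1) p) = F n (R.d n p)) →
        ∀ (n : ℕ) (φ ψ : homCocycles R n),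
          (∀ p : R.P n, (ψ : R.P n →ₗ[A] M) p
              = f ((φ : R.P n →ₗ[A] M) p) - (φ : R.P n →ₗ[A] M) (F n p)) →
          Nabla R n (Submodule.Quotient.mk φ) = Submodule.Quotient.mk ψ) ∧
      (∀ (R R' : ProjResolution k A M) (α : ∀ n, R'.P n →ₗ[A] R.P n),
        (∀ p, R.aug (α 0 p) = R'.aug p) →
        (∀ n p, R.d n (α (n + 1) p) = α n (R'.d n p)) →
        ∀ (n : ℕ) (φ ξ : homCocycles R n) (φ' ξ' : homCocycles R' n),
          (∀ p : R'.P n, (φ' : R'.P n →ₗ[A] M) p = (φ : R.P n →ₗ[A] M) (α n p)) →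
          (∀ p : R'.P n, (ξ' : R'.P n →ₗ[A] M) p = (ξ : R.P n →ₗ[A] M) (α n p)) →
          Nabla R n (Submodule.Quotient.mk φ) = Submodule.Quotient.mk ξ →
          Nabla R' n (Submodule.Quotient.mk φ') = Submodule.Quotient.mk ξ') := by
  choose F hF using fun R : ProjResolution k A M => R.exists_isDeltaLifting hδ hf
  refine ⟨fun R n => (hF R).nabla hf n, ?_, ?_⟩
  · intro R G hG haug hd n φ ψ hψ
    have hL : R.IsDeltaLifting δ f G := ⟨hG, haug, hd⟩
    have hψ' : (ψ : R.P n →ₗ[A] M) = deltaCommutator (hG n) hf φ := LinearMap.ext hψ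
    rw [(hF R).nabla_mk_eq_iff, hψ']
    exact hL.deltaCommutator_comp_sub_mem (hF R) hf (fun _ => LinearMap.id) (fun _ => rfl)
      (fun _ _ => rfl) φ.2
  · intro R R' α haug hα n φ ξ φ' ξ' hφ' hξ' h
    have hφ : (φ' : R'.P n →ₗ[A] M) = (φ : R.P n →ₗ[A] M) ∘ₗ α n := LinearMap.ext hφ'
    have hξ : (ξ' : R'.P n →ₗ[A] M) = (ξ : R.P n →ₗ[A] M) ∘ₗ α n := LinearMap.ext hξ'
    rw [(hF R).nabla_mk_eq_iff] at h
    rw [(hF R').nabla_mk_eq_iff, hφ, hξ]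
    have hsum := add_mem ((hF R).deltaCommutator_comp_sub_mem (hF R') hf α haug hα φ.2)
      (comp_chainMap_mem_homCoboundaries α hα h)
    rwa [LinearMap.sub_comp, sub_add_sub_cancel] at hsum
end

section
/- Let Q be a quiver with finitely many vertices and finitely many arrows which is connected (any two vertices can be joined by a finite sequence of arrows traversed in either direction), has no sources and no sinks (every vertex is the target of at least one arrow and the source of at least one arrow). Fix an integer L ≥ 1, and on the set of paths of length L in Q define the relation ∼ by: w ∼ w' if and only if there exists a path u of length L + 1 such that w is the prefix of u of length L and w' is the suffix of u of length L (equivalently, there exist arrows α and β with wα = βw' as paths of length L + 1). Let ≈ be the equivalence relation generated by ∼. Then any two paths of length L in Q are ≈-equivalent, i.e. ≈ has a single equivalence class. -/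
/-- A path of length `L` in a quiver with arrow set `E` and source/target maps
`s, t : E → V`: a sequence of `L` composable arrows. -/
structure QuiverPath {V E : Type*} (s t : E → V) (L : ℕ) where
  arrows : Fin L → E
  comp : ∀ (i : ℕ) (h : i + 1 < L),
    t (arrows ⟨i, Nat.lt_of_succ_lt h⟩) = s (arrows ⟨i + 1, h⟩)

/-- The relation `∼` on paths of length `L`: `w ∼ w'` iff there is a path `u` of length
`L + 1` such that `w` is the prefix of `u` of length `L` and `w'` is the suffix of `u`
of length `L`. -/
def pathShiftRel {V E : Type*} (s t : E → V) (L : ℕ)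
    (w w' : QuiverPath s t L) : Prop :=
  ∃ u : QuiverPath s t (L + 1),
    (∀ i : Fin L, u.arrows i.castSucc = w.arrows i) ∧
    (∀ i : Fin L, u.arrows i.succ = w'.arrows i)

namespace QuiverPath

variable {V E : Type*} {s t : E → V}

theorem ext_arrows {L : ℕ} {w w' : QuiverPath s t L} (h : ∀ i, w.arrows i = w'.arrows i) :
    w = w' := by
  cases w
  cases w'
  congr
  exact funext h

/-- The path of length `L` formed by the arrows `a n, …, a (n + L - 1)` of an infinite path. -/
def window (a : ℕ → E) (ha : ∀ n, t (a n) = s (a (n + 1))) (L n : ℕ) : QuiverPath s t L where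
  arrows i := a (n + i)
  comp i _ := ha (n + i)

theorem eqvGen_window (a : ℕ → E) (ha : ∀ n, t (a n) = s (a (n + 1))) (L n : ℕ) :
    Relation.EqvGen (pathShiftRel s t L) (window a ha L 0) (window a ha L n) := by
  induction n with
  | zero => exact .refl _
  | succ n ih =>
    refine ih.trans _ _ _ (.rel _ _ ⟨window a ha (L + 1) n, fun i => rfl, fun i => ?_⟩)
    simp only [window, Fin.val_succ]
    congr 1
    omega

/-- A path is equivalent to the initial window of any infinite path that continues it. -/
theorem eqvGen_window_of_target_eq {m : ℕ} (w : QuiverPath s t (m + 1)) (b : ℕ → E)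
    (hb : ∀ n, t (b n) = s (b (n + 1))) (hwb : t (w.arrows (Fin.last m)) = s (b 0)) :
    Relation.EqvGen (pathShiftRel s t (m + 1)) w (window b hb (m + 1) 0) := by
  let a : ℕ → E := fun n => if h : n < m + 1 then w.arrows ⟨n, h⟩ else b (n - (m + 1))
  have ha : ∀ n, t (a n) = s (a (n + 1)) := by
    intro n
    rcases lt_trichotomy n m with h | rfl | h
    · have h1 : n < m + 1 := by omega
      have h2 : n + 1 < m + 1 := by omega
      simp only [a, dif_pos h1, dif_pos h2]
      exact w.comp n h2
    · simpa [a, Fin.last] using hwb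
    · have h1 : ¬ n < m + 1 := by omega
      have h2 : ¬ n + 1 < m + 1 := by omega
      simp only [a, dif_neg h1, dif_neg h2]
      rw [hb, show n + 1 - (m + 1) = n - (m + 1) + 1 by omega]
  have h0 : window a ha (m + 1) 0 = w := ext_arrows fun i => by
    simp [window, a, -Order.lt_add_one_iff]
  have h1 : window a ha (m + 1) (m + 1) = window b hb (m + 1) 0 := ext_arrows fun i => by
    have hi : ¬ m + 1 + (i : ℕ) < m + 1 := by omega
    simp only [window, a, dif_neg hi, Nat.add_sub_cancel_left, Nat.zero_add]
  simpa only [h0, h1] using eqvGen_window a ha (m + 1) (m + 1)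

theorem exists_target_eq (hnosource : ∀ v : V, ∃ e : E, t e = v) (m : ℕ) (v : V) :
    ∃ w : QuiverPath s t (m + 1), t (w.arrows (Fin.last m)) = v := by
  choose g hg using hnosource
  refine ⟨⟨fun i => g ((fun x => s (g x))^[m - i] v), fun i h => ?_⟩, by simp [hg]⟩
  rw [hg]
  simp only
  rw [show m - i = m - (i + 1) + 1 by omega, Function.iterate_succ_apply']

theorem exists_infinite_path (hnosink : ∀ v : V, ∃ e : E, s e = v) (v : V) :
    ∃ a : ℕ → E, (∀ n, t (a n) = s (a (n + 1))) ∧ s (a 0) = v := by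
  choose f hf using hnosink
  refine ⟨fun n => f ((fun x => t (f x))^[n] v), fun n => ?_, by simp [hf]⟩
  simp only [hf, Function.iterate_succ_apply']

end QuiverPath

/-- In a finite connected quiver without sources and sinks, the equivalence relation
generated by `∼` on the set of paths of length `L ≥ 1` has a single equivalence class:
any two paths of length `L` are `≈`-equivalent. -/
theorem paths_single_equivalence_class
    {V E : Type*} [Fintype V] [Fintype E] (s t : E → V)
    (hconn : ∀ u v : V, Relation.ReflTransGen
      (fun x y => ∃ e : E, (s e = x ∧ t e = y) ∨ (s e = y ∧ t e = x)) u v)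
    (hnosink : ∀ v : V, ∃ e : E, s e = v)
    (hnosource : ∀ v : V, ∃ e : E, t e = v)
    (L : ℕ) (hL : 1 ≤ L) :
    ∀ w w' : QuiverPath s t L, Relation.EqvGen (pathShiftRel s t L) w w' := by
  obtain ⟨m, rfl⟩ : ∃ m, L = m + 1 := ⟨L - 1, by omega⟩
  choose a ha ha0 using QuiverPath.exists_infinite_path (t := t) hnosink
  let P : V → QuiverPath s t (m + 1) := fun v => QuiverPath.window (a v) (ha v) (m + 1) 0
  have path_equiv : ∀ w : QuiverPath s t (m + 1),
      Relation.EqvGen (pathShiftRel s t (m + 1)) w (P (t (w.arrows (Fin.last m)))) :=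
    fun w => w.eqvGen_window_of_target_eq _ _ (ha0 _).symm
  have arrow_equiv : ∀ e : E,
      Relation.EqvGen (pathShiftRel s t (m + 1)) (P (s e)) (P (t e)) := by
    intro e
    obtain ⟨w, hw⟩ := QuiverPath.exists_target_eq (s := s) hnosource m (s e)
    let b : ℕ → E := fun n => Nat.casesOn n e (a (t e))
    have hb : ∀ n, t (b n) = s (b (n + 1)) := by
      rintro (_ | n)
      · exact (ha0 _).symm
      · exact ha _ n
    have hshift : QuiverPath.window b hb (m + 1) 1 = P (t e) :=
      QuiverPath.ext_arrows fun i => by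
        simp only [QuiverPath.window, P, b, Nat.add_comm 1, Nat.zero_add]
    have h1 := path_equiv w
    rw [hw] at h1
    have h2 := QuiverPath.eqvGen_window b hb (m + 1) 1
    rw [hshift] at h2
    exact (h1.symm _ _).trans _ _ _ ((w.eqvGen_window_of_target_eq b hb hw).trans _ _ _ h2)
  have vertex_equiv : ∀ u v : V,
      Relation.EqvGen (pathShiftRel s t (m + 1)) (P u) (P v) := by
    intro u v
    induction hconn u v with
    | refl => exact .refl _
    | tail _ h ih =>
      obtain ⟨e, ⟨rfl, rfl⟩ | ⟨rfl, rfl⟩⟩ := h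
      · exact ih.trans _ _ _ (arrow_equiv e)
      · exact ih.trans _ _ _ ((arrow_equiv e).symm _ _)
  intro w w'
  exact (path_equiv w).trans _ _ _
    ((vertex_equiv _ _).trans _ _ _ ((path_equiv w').symm _ _))
end
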